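/- Let 0 < s < t, let γ_r denote the Gaussian probability measure on ℝ with mean 0 and variance r², let ν be a probability measure on ℝ, and let T_s, T_t : ℝ ≃ ℝ be measurable equivalences with (T_s)_*(ν ∗ γ_s) = ν and (T_t)_*(ν ∗ γ_t) = ν (exact deterministic denoisers for ν at noise levels s and t). Then for every probability measure μ on ℝ, KL((T_t)_*(μ ∗ γ_t) ‖ ν) ≤ KL((T_s)_*(μ ∗ γ_s) ‖ ν). (The second part of the paper's Theorem 1 with exact deterministic denoisers: using a higher noise level yields a KL divergence to the source distribution at most that obtained with a lower noise level.) -/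

import Mathlib

open MeasureTheory ProbabilityTheory

/- Kullback–Leibler divergence: `∫ log (dμ/dν) dμ` if `μ ≪ ν` (and the log-likelihood ratio
is integrable), and `+∞` otherwise. -/
open scoped Classical in
noncomputable def klDiv {α : Type*} [MeasurableSpace α] (μ ν : Measure α) : EReal :=
  if μ ≪ ν ∧ Integrable (llr μ ν) μ then ((∫ x, llr μ ν x ∂μ : ℝ) : EReal) else ⊤

theorem klDiv_eq_coe {α : Type*} [MeasurableSpace α] (μ ν : Measure α)
    [IsProbabilityMeasure μ] [IsProbabilityMeasure ν] :
    klDiv μ ν = (InformationTheory.klDiv μ ν : EReal) := by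
  by_cases h : μ ≪ ν ∧ Integrable (llr μ ν) μ
  · have h_nonneg := InformationTheory.integral_llr_add_sub_measure_univ_nonneg h.1 h.2
    simp only [probReal_univ, add_sub_cancel_right] at h_nonneg
    rw [klDiv, if_pos h, InformationTheory.klDiv_of_ac_of_integrable h.1 h.2]
    simp [h_nonneg]
  · rw [klDiv, if_neg h, not_ne_iff.mp (mt InformationTheory.klDiv_ne_top_iff.mp h)]
    rfl

theorem InformationTheory.klDiv_map_measurableEquiv {α β : Type*} [MeasurableSpace α]
    [MeasurableSpace β] (μ ν : Measure α) [IsFiniteMeasure μ] [IsFiniteMeasure ν] (e : α ≃ᵐ β) :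
    InformationTheory.klDiv (μ.map e) (ν.map e) = InformationTheory.klDiv μ ν := by
  refine le_antisymm (klDiv_map_le μ ν e.measurable) ?_
  simpa using klDiv_map_le (μ.map e) (ν.map e) e.symm.measurable

theorem InformationTheory.klDiv_conv_right_le {M : Type*} [AddMonoid M] [MeasurableSpace M]
    [MeasurableAdd₂ M] (μ ν ρ : Measure M) [IsFiniteMeasure μ] [IsFiniteMeasure ν]
    [IsProbabilityMeasure ρ] :
    InformationTheory.klDiv (μ.conv ρ) (ν.conv ρ) ≤ InformationTheory.klDiv μ ν := by
  calc InformationTheory.klDiv (μ.conv ρ) (ν.conv ρ)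
      ≤ InformationTheory.klDiv (μ.prod ρ) (ν.prod ρ) := klDiv_map_le _ _ measurable_add
    _ = InformationTheory.klDiv μ ν := by
      rw [← Measure.compProd_const, ← Measure.compProd_const, klDiv_compProd_left]

theorem conv_gaussianReal_conv_tsub {u v : NNReal} (huv : u ≤ v) (μ : Measure ℝ) [SFinite μ] :
    (μ.conv (gaussianReal 0 u)).conv (gaussianReal 0 (v - u)) = μ.conv (gaussianReal 0 v) := by
  rw [Measure.conv_assoc, gaussianReal_conv_gaussianReal, add_zero, add_tsub_cancel_of_le huv]

theorem klDiv_map_conv_gaussianReal_le {u v : NNReal} (huv : u ≤ v) (μ ν : Measure ℝ)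
    [IsProbabilityMeasure μ] [IsProbabilityMeasure ν] (Tu Tv : ℝ ≃ᵐ ℝ)
    (hTu : (ν.conv (gaussianReal 0 u)).map Tu = ν)
    (hTv : (ν.conv (gaussianReal 0 v)).map Tv = ν) :
    klDiv ((μ.conv (gaussianReal 0 v)).map Tv) ν ≤
      klDiv ((μ.conv (gaussianReal 0 u)).map Tu) ν := by
  have (w : NNReal) (T : ℝ ≃ᵐ ℝ) : IsProbabilityMeasure ((μ.conv (gaussianReal 0 w)).map T) :=
    Measure.isProbabilityMeasure_map T.measurable.aemeasurable
  rw [klDiv_eq_coe, klDiv_eq_coe, EReal.coe_ennreal_le_coe_ennreal_iff]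
  calc InformationTheory.klDiv ((μ.conv (gaussianReal 0 v)).map Tv) ν
      = InformationTheory.klDiv (μ.conv (gaussianReal 0 v)) (ν.conv (gaussianReal 0 v)) := by
        rw [← InformationTheory.klDiv_map_measurableEquiv _ (ν.conv _) Tv, hTv]
    _ ≤ InformationTheory.klDiv (μ.conv (gaussianReal 0 u)) (ν.conv (gaussianReal 0 u)) := by
        rw [← conv_gaussianReal_conv_tsub huv μ, ← conv_gaussianReal_conv_tsub huv ν]
        exact InformationTheory.klDiv_conv_right_le _ _ _
    _ = InformationTheory.klDiv ((μ.conv (gaussianReal 0 u)).map Tu) ν := by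
        rw [← InformationTheory.klDiv_map_measurableEquiv _ (ν.conv _) Tu, hTu]

/-- Second part of Theorem 1 of the paper with exact deterministic invertible denoisers:
if `T_s` and `T_t` are exact deterministic denoisers for ν at noise levels 0 < s < t
(pushing the noised source laws back to ν), then denoising from the higher noise level t
yields a KL divergence to ν at most that obtained from the lower noise level s. -/
theorem klDiv_map_conv_gaussian_anti (s t : ℝ) (hs : 0 < s) (hst : s < t)
    (ν : Measure ℝ) [IsProbabilityMeasure ν] (Ts Tt : ℝ ≃ᵐ ℝ)
    (hTs : (ν.conv (gaussianReal 0 ⟨s ^ 2, sq_nonneg s⟩)).map Ts = ν)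
    (hTt : (ν.conv (gaussianReal 0 ⟨t ^ 2, sq_nonneg t⟩)).map Tt = ν) :
    ∀ (μ : Measure ℝ), IsProbabilityMeasure μ →
      klDiv ((μ.conv (gaussianReal 0 ⟨t ^ 2, sq_nonneg t⟩)).map Tt) ν ≤
        klDiv ((μ.conv (gaussianReal 0 ⟨s ^ 2, sq_nonneg s⟩)).map Ts) ν := by
  intro μ hμ
  have h_sq : s ^ 2 ≤ t ^ 2 := pow_le_pow_left₀ hs.le hst.le 2
  exact klDiv_map_conv_gaussianReal_le (u := ⟨s ^ 2, sq_nonneg s⟩) (v := ⟨t ^ 2, sq_nonneg t⟩)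
    h_sq μ ν Ts Tt hTs hTt
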